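/- Let n ∈ ℕ and L, C, R ∈ ℝ_max^{n×n}, and consider the lifted system with matrices Ā, B̄, H and semimodule K = Im H*. Then there exists k̂ ∈ ℕ such that φ^k(K) ∩ ℝ^{2n} = ∅ for all k ≥ k̂ (i.e., the sequence φ^k(K) ∩ ℝ^{2n} converges in finitely many steps to the empty set) if and only if the system (8) is not weakly consistent. -/

import Mathlib

noncomputable section

open scoped Classical

/-- Max-plus matrix-vector product: `(A ⊗ x)_i = sup_j (A_{ij} + x_j)`. -/
def mpMulVec {N P : Type*} (A : N → P → EReal) (x : P → EReal) : N → EReal :=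
  fun i => ⨆ j, A i j + x j

/-- Max-plus matrix-matrix product. -/
def mpMulMat {N P Q : Type*} (A : N → P → EReal) (B : P → Q → EReal) : N → Q → EReal :=
  fun i j => ⨆ k, A i k + B k j

/-- Max-plus identity matrix `E`. -/
def mpId {N : Type*} [DecidableEq N] : N → N → EReal :=
  fun i j => if i = j then (0 : EReal) else ⊥

/-- Max-plus matrix powers: `A^0 = E`, `A^{k+1} = A^k ⊗ A`. -/
def mpPow {N : Type*} [DecidableEq N] (A : N → N → EReal) : ℕ → N → N → EReal
  | 0 => mpId
  | k + 1 => mpMulMat (mpPow A k) A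

/-- Kleene star `A* = sup_{k ≥ 0} A^k` (entrywise supremum). -/
def mpStar {N : Type*} [DecidableEq N] (A : N → N → EReal) : N → N → EReal :=
  fun i j => ⨆ k : ℕ, mpPow A k i j

/-- Image of a matrix: `Im U = { U ⊗ u : u ∈ ℝ_max^P } ⊆ ℝ_max^N`. -/
def mpIm {N P : Type*} (U : N → P → EReal) : Set (N → EReal) :=
  { x | (∀ i, x i ≠ ⊤) ∧ ∃ u : P → EReal, (∀ j, u j ≠ ⊤) ∧ x = mpMulVec U u }

/-- Existence of a positive-weight circuit in the precedence graph `G(A)`. -/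
def hasPosCircuit {N : Type*} (A : N → N → EReal) : Prop :=
  ∃ (l : ℕ) (p : ℕ → N), p l = p 0 ∧ (∀ t < l, A (p (t + 1)) (p t) ≠ ⊥) ∧
    0 < ∑ t ∈ Finset.range l, A (p (t + 1)) (p t)

/-- The block-tridiagonal matrix `M_[K]` with diagonal blocks `C`,
superdiagonal blocks `L`, subdiagonal blocks `R`. -/
def MK {n : ℕ} (L C R : Fin n → Fin n → EReal) (K : ℕ) :
    Fin K × Fin n → Fin K × Fin n → EReal :=
  fun p q =>
    if p.1.val = q.1.val then C p.2 q.2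
    else if p.1.val + 1 = q.1.val then L p.2 q.2
    else if q.1.val + 1 = p.1.val then R p.2 q.2
    else ⊥

/-- The infinite block-tridiagonal matrix `M_[∞]`, indexed by `ℕ × Fin n`. -/
def Minf {n : ℕ} (L C R : Fin n → Fin n → EReal) :
    ℕ × Fin n → ℕ × Fin n → EReal :=
  fun p q =>
    if p.1 = q.1 then C p.2 q.2
    else if p.1 + 1 = q.1 then L p.2 q.2
    else if q.1 + 1 = p.1 then R p.2 q.2
    else ⊥

/-- Existence of a finite real trajectory `x : {1,…,K} → ℝ^n` satisfying
`x(k) ≥ C ⊗ x(k)`, `x(k) ≥ L ⊗ x(k+1)` and `x(k+1) ≥ R ⊗ x(k)`. -/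
def FiniteTraj {n : ℕ} (L C R : Fin n → Fin n → EReal) (K : ℕ) : Prop :=
  ∃ x : Fin K → Fin n → ℝ,
    (∀ k : Fin K, ∀ i, mpMulVec C (fun j => (x k j : EReal)) i ≤ (x k i : EReal)) ∧
    (∀ k : Fin K, ∀ h : k.val + 1 < K, ∀ i,
      mpMulVec L (fun j => (x ⟨k.val + 1, h⟩ j : EReal)) i ≤ (x k i : EReal) ∧
      mpMulVec R (fun j => (x k j : EReal)) i ≤ (x ⟨k.val + 1, h⟩ i : EReal))

/-- Weak consistency of system (8). -/
def WeaklyConsistent {n : ℕ} (L C R : Fin n → Fin n → EReal) : Prop :=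
  ∀ K : ℕ, FiniteTraj L C R K

/-- Consistency of system (8): existence of an infinite real trajectory. -/
def Consistent {n : ℕ} (L C R : Fin n → Fin n → EReal) : Prop :=
  ∃ x : ℕ → Fin n → ℝ, ∀ k : ℕ,
    (∀ i, mpMulVec L (fun j => (x (k + 1) j : EReal)) i ≤ (x k i : EReal)) ∧
    (∀ i, mpMulVec C (fun j => (x k j : EReal)) i ≤ (x k i : EReal)) ∧
    (∀ i, mpMulVec R (fun j => (x k j : EReal)) i ≤ (x (k + 1) i : EReal))

/-- The sequence `Π_0 = C*`, `Π_{k+1} = (L ⊗ Π_k ⊗ R ⊕ C)*`. -/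
def PiSeq {n : ℕ} (L C R : Fin n → Fin n → EReal) : ℕ → Fin n → Fin n → EReal
  | 0 => mpStar C
  | k + 1 => mpStar (fun i j => max (mpMulMat (mpMulMat L (PiSeq L C R k)) R i j) (C i j))

/-- Lifted matrix `Ā = [[ε, E], [ε, ε]]`. -/
def Abar (n : ℕ) : Fin n ⊕ Fin n → Fin n ⊕ Fin n → EReal :=
  fun p q =>
    match p, q with
    | Sum.inl i, Sum.inr j => mpId i j
    | _, _ => ⊥

/-- Lifted matrix `B̄ = [ε; E]`. -/
def Bbar (n : ℕ) : Fin n ⊕ Fin n → Fin n → EReal :=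
  fun p j =>
    match p with
    | Sum.inl _ => ⊥
    | Sum.inr i => mpId i j

/-- Lifted matrix `H = [[C, L], [R, C]]`. -/
def Hmat {n : ℕ} (L C R : Fin n → Fin n → EReal) :
    Fin n ⊕ Fin n → Fin n ⊕ Fin n → EReal :=
  fun p q =>
    match p, q with
    | Sum.inl i, Sum.inl j => C i j
    | Sum.inl i, Sum.inr j => L i j
    | Sum.inr i, Sum.inl j => R i j
    | Sum.inr i, Sum.inr j => C i j

/-- The semimodule `K = Im H*`. -/
def Kset {n : ℕ} (L C R : Fin n → Fin n → EReal) : Set (Fin n ⊕ Fin n → EReal) :=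
  mpIm (mpStar (Hmat L C R))

/-- The map `φ(X) = X ∩ { x ∈ ℝ_max^N : ∃ u ∈ ℝ_max^M, A ⊗ x ⊕ B ⊗ u ∈ X }`. -/
def mpPhi {N M : Type*} (A : N → N → EReal) (B : N → M → EReal)
    (X : Set (N → EReal)) : Set (N → EReal) :=
  X ∩ { x | (∀ i, x i ≠ ⊤) ∧ ∃ u : M → EReal, (∀ j, u j ≠ ⊤) ∧
    (fun i => max (mpMulVec A x i) (mpMulVec B u i)) ∈ X }

/-- Controlled trajectory: `x(1) = x0`, `x(k+1) = A ⊗ x(k) ⊕ B ⊗ u(k)`. -/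
def mpTraj {N M : Type*} (A : N → N → EReal) (B : N → M → EReal)
    (x0 : N → EReal) (u : ℕ → M → EReal) : ℕ → N → EReal
  | 0 => x0
  | k + 1 => fun i => max (mpMulVec A (mpTraj A B x0 u k) i) (mpMulVec B (u k) i)

/-- `K^♯`: states of `K` from which some control keeps the whole trajectory in `K`. -/
def mpKsharp {N M : Type*} (A : N → N → EReal) (B : N → M → EReal)
    (K : Set (N → EReal)) : Set (N → EReal) :=
  { x | x ∈ K ∧ ∃ u : ℕ → M → EReal, (∀ k j, u k j ≠ ⊤) ∧
    ∀ k : ℕ, mpTraj A B x u k ∈ K }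

/-- Real vectors `ℝ^N` inside `ℝ̄^N`. -/
def RealVecs {N : Type*} : Set (N → EReal) := { x | ∀ i, x i ≠ ⊤ ∧ x i ≠ ⊥ }

/-- Semimodules of `ℝ_max^N`: closed under entrywise max and scalar addition. -/
def IsSemimodule {N : Type*} (X : Set (N → EReal)) : Prop :=
  (∀ x ∈ X, ∀ i, x i ≠ ⊤) ∧
  (∀ x ∈ X, ∀ y ∈ X, (fun i => max (x i) (y i)) ∈ X) ∧
  (∀ x ∈ X, ∀ lam : EReal, lam ≠ ⊤ → (fun i => lam + x i) ∈ X)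

/-- Embedding of the first two block indices into `Fin (k+2) × Fin n`. -/
def emb2 {n : ℕ} (k : ℕ) : Fin n ⊕ Fin n → Fin (k + 2) × Fin n
  | Sum.inl i => (⟨0, by omega⟩, i)
  | Sum.inr i => (⟨1, by omega⟩, i)

/-- `S_{k+2}`: top-left `2n × 2n` submatrix of `(M_[k+2])*`. -/
def Smat {n : ℕ} (L C R : Fin n → Fin n → EReal) (k : ℕ) :
    Fin n ⊕ Fin n → Fin n ⊕ Fin n → EReal :=
  fun p q => mpStar (MK L C R (k + 2)) (emb2 k p) (emb2 k q)

/-- Embedding of the first two block indices into `ℕ × Fin n`. -/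
def embInf {n : ℕ} : Fin n ⊕ Fin n → ℕ × Fin n
  | Sum.inl i => (0, i)
  | Sum.inr i => (1, i)

/-- `S_∞`: top-left `2n × 2n` submatrix of `(M_[∞])*`. -/
def Sinf {n : ℕ} (L C R : Fin n → Fin n → EReal) :
    Fin n ⊕ Fin n → Fin n ⊕ Fin n → EReal :=
  fun p q => mpStar (Minf L C R) (embInf p) (embInf q)

theorem add_iSup_le_of_ne_top {ι : Sort*} {c b : EReal} {f : ι → EReal} (hc : c ≠ ⊤)
    (h : ∀ i, c + f i ≤ b) : c + ⨆ i, f i ≤ b := by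
  induction c with
  | bot => simp
  | top => exact absurd rfl hc
  | coe c =>
    rw [add_comm, ← EReal.le_sub_iff_add_le (by simp) (by simp)]
    refine iSup_le fun i => ?_
    rw [EReal.le_sub_iff_add_le (by simp) (by simp), add_comm]
    exact h i

theorem iSup_add_le_of_ne_top {ι : Sort*} {c b : EReal} {f : ι → EReal} (hc : c ≠ ⊤)
    (h : ∀ i, f i + c ≤ b) : (⨆ i, f i) + c ≤ b := by
  rw [add_comm]
  exact add_iSup_le_of_ne_top hc fun i => by rw [add_comm]; exact h i

theorem add_mpPow_le {N : Type*} [DecidableEq N] {A : N → N → EReal} (hA : ∀ i j, A i j ≠ ⊤)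
    (k : ℕ) (p q j : N) : A p q + mpPow A k q j ≤ mpPow A (k + 1) p j := by
  induction k generalizing j with
  | zero =>
    by_cases h : q = j
    · subst h
      refine le_trans ?_ (le_iSup (fun r => mpPow A 0 p r + A r q) p)
      simp [mpPow, mpId]
    · simp [mpPow, mpId, h]
  | succ k ih =>
    refine add_iSup_le_of_ne_top (hA p q) fun r => ?_
    rw [← add_assoc]
    exact (add_le_add_left (ih r) _).trans
      (le_iSup (fun r => mpPow A (k + 1) p r + A r j) r)

theorem add_mpStar_le {N : Type*} [DecidableEq N] {A : N → N → EReal} (hA : ∀ i j, A i j ≠ ⊤)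
    (p q j : N) : A p q + mpStar A q j ≤ mpStar A p j :=
  add_iSup_le_of_ne_top (hA p q) fun k =>
    (add_mpPow_le hA k p q j).trans (le_iSup (fun k => mpPow A k p j) (k + 1))

theorem mpPow_add_le {N : Type*} [DecidableEq N] {A : N → N → EReal} {x : N → EReal}
    (hx : ∀ i, x i ≠ ⊤) (h : ∀ p q, A p q + x q ≤ x p) (k : ℕ) (p q : N) :
    mpPow A k p q + x q ≤ x p := by
  induction k generalizing q with
  | zero =>
    by_cases hpq : p = q
    · subst hpq; simp [mpPow, mpId]
    · simp [mpPow, mpId, hpq]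
  | succ k ih =>
    refine iSup_add_le_of_ne_top (hx q) fun r => ?_
    rw [add_assoc]
    exact (add_le_add_right (h r q) _).trans (ih r)

/-- The image of the Kleene star consists of the subsolutions `A ⊗ x ≤ x`. -/
theorem mem_mpIm_mpStar_iff {N : Type*} [DecidableEq N] {A : N → N → EReal}
    (hA : ∀ i j, A i j ≠ ⊤) (x : N → EReal) :
    x ∈ mpIm (mpStar A) ↔ (∀ i, x i ≠ ⊤) ∧ ∀ p q, A p q + x q ≤ x p := by
  constructor
  · rintro ⟨hx, u, -, rfl⟩
    refine ⟨hx, fun p q => add_iSup_le_of_ne_top (hA p q) fun j => ?_⟩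
    rw [← add_assoc]
    exact (add_le_add_left (add_mpStar_le hA p q j) _).trans
      (le_iSup (fun j => mpStar A p j + u j) j)
  · rintro ⟨hx, h⟩
    refine ⟨hx, x, hx, funext fun p => le_antisymm ?_ ?_⟩
    · refine le_trans ?_ (le_iSup (fun j => mpStar A p j + x j) p)
      have h0 : (0 : EReal) ≤ mpStar A p p :=
        le_trans (by simp [mpPow, mpId]) (le_iSup (fun k => mpPow A k p p) 0)
      simpa using add_le_add_left h0 (x p)
    · exact iSup_le fun q => iSup_add_le_of_ne_top (hx q) fun k => mpPow_add_le hx h k p q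

theorem iSup_mpId_add {N : Type*} [DecidableEq N] (f : N → EReal) (i : N) :
    ⨆ j, mpId i j + f j = f i := by
  refine le_antisymm (iSup_le fun j => ?_) ?_
  · by_cases h : i = j
    · subst h; simp [mpId]
    · simp [mpId, h]
  · exact le_trans (by simp [mpId]) (le_iSup (fun j => mpId i j + f j) i)

/-- The lifted dynamics shift the state by one block and append the control. -/
theorem Abar_Bbar_step {n : ℕ} (x : Fin n ⊕ Fin n → EReal) (u : Fin n → EReal) :
    (fun i => max (mpMulVec (Abar n) x i) (mpMulVec (Bbar n) u i)) =
      Sum.elim (x ∘ Sum.inr) u := by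
  funext i
  rcases i with i | i
  · simp [mpMulVec, Abar, Bbar, iSup_sum, iSup_mpId_add]
  · simp [mpMulVec, Abar, Bbar, iSup_mpId_add]

/-- A sequence satisfying the inequalities of system (8) on its first `K` terms. -/
def IsTraj {n : ℕ} (L C R : Fin n → Fin n → EReal) (K : ℕ) (x : ℕ → Fin n → EReal) : Prop :=
  (∀ k < K, ∀ i j, C i j + x k j ≤ x k i) ∧
    ∀ k, k + 1 < K → ∀ i j, L i j + x (k + 1) j ≤ x k i ∧ R i j + x k j ≤ x (k + 1) i

section

variable {n : ℕ} {L C R : Fin n → Fin n → EReal}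

theorem IsTraj.mono {K K' : ℕ} {x : ℕ → Fin n → EReal} (h : IsTraj L C R K x) (hK : K' ≤ K) :
    IsTraj L C R K' x :=
  ⟨fun k hk => h.1 k (hk.trans_le hK), fun k hk => h.2 k (hk.trans_le hK)⟩

theorem IsTraj.tail {K : ℕ} {x : ℕ → Fin n → EReal} (h : IsTraj L C R (K + 1) x) :
    IsTraj L C R K (fun k => x (k + 1)) :=
  ⟨fun k hk => h.1 (k + 1) (by omega), fun k hk => h.2 (k + 1) (by omega)⟩

theorem mem_Kset_iff (hL : ∀ i j, L i j ≠ ⊤) (hC : ∀ i j, C i j ≠ ⊤) (hR : ∀ i j, R i j ≠ ⊤)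
    (x : ℕ → Fin n → EReal) :
    Sum.elim (x 0) (x 1) ∈ Kset L C R ↔
      (∀ i, x 0 i ≠ ⊤ ∧ x 1 i ≠ ⊤) ∧ IsTraj L C R 2 x := by
  have hH : ∀ i j, Hmat L C R i j ≠ ⊤ := by
    rintro (i | i) (j | j)
    exacts [hC i j, hL i j, hR i j, hC i j]
  rw [Kset, mem_mpIm_mpStar_iff hH]
  constructor
  · rintro ⟨ht, h⟩
    refine ⟨fun i => ⟨ht (.inl i), ht (.inr i)⟩, fun k hk i j => ?_, fun k hk i j => ?_⟩
    · interval_cases k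
      exacts [h (.inl i) (.inl j), h (.inr i) (.inr j)]
    · obtain rfl : k = 0 := by omega
      exact ⟨h (.inl i) (.inr j), h (.inr i) (.inl j)⟩
  · rintro ⟨ht, h⟩
    constructor
    · rintro (i | i)
      exacts [(ht i).1, (ht i).2]
    · rintro (i | i) (j | j)
      exacts [h.1 0 (by omega) i j, (h.2 0 (by omega) i j).1, (h.2 0 (by omega) i j).2,
        h.1 1 (by omega) i j]

theorem iterate_mpPhi_subset {N M : Type*} (A : N → N → EReal) (B : N → M → EReal)
    (X : Set (N → EReal)) (k : ℕ) : (mpPhi A B)^[k] X ⊆ X := by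
  induction k with
  | zero => exact subset_rfl
  | succ k ih =>
    rw [Function.iterate_succ_apply']
    exact Set.inter_subset_left.trans ih

theorem exists_isTraj_of_mem_iterate (hL : ∀ i j, L i j ≠ ⊤) (hC : ∀ i j, C i j ≠ ⊤)
    (hR : ∀ i j, R i j ≠ ⊤) (k : ℕ) (x : Fin n ⊕ Fin n → EReal)
    (hx : x ∈ (mpPhi (Abar n) (Bbar n))^[k] (Kset L C R)) :
    ∃ y : ℕ → Fin n → EReal, Sum.elim (y 0) (y 1) = x ∧ (∀ l i, y l i ≠ ⊤) ∧
      IsTraj L C R (k + 2) y := by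
  have key : x ∈ Kset L C R := iterate_mpPhi_subset _ _ _ _ hx
  induction k generalizing x with
  | zero =>
    let y : ℕ → Fin n → EReal := fun l => if l = 0 then x ∘ Sum.inl else x ∘ Sum.inr
    have hyx : Sum.elim (y 0) (y 1) = x := by simp [y]
    rw [← hyx, mem_Kset_iff hL hC hR] at key
    refine ⟨y, hyx, fun l i => ?_, key.2⟩
    by_cases hl : l = 0
    · subst hl; exact (key.1 i).1
    · simpa [y, hl] using (key.1 i).2
  | succ k ih =>
    rw [Function.iterate_succ_apply'] at hx
    obtain ⟨-, -, u, -, hu⟩ := hx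
    rw [Abar_Bbar_step] at hu
    obtain ⟨y, hy, hyt, hyT⟩ := ih _ hu (iterate_mpPhi_subset _ _ _ _ hu)
    have hy0 : y 0 = x ∘ Sum.inr := funext fun i => congrFun hy (Sum.inl i)
    let z : ℕ → Fin n → EReal := fun l => Nat.casesOn l (x ∘ Sum.inl) y
    have hzx : Sum.elim (z 0) (z 1) = x := by simp [z, hy0]
    rw [← hzx, mem_Kset_iff hL hC hR] at key
    refine ⟨z, hzx, ?_, ?_, ?_⟩
    · rintro (_ | l)
      exacts [fun i => (key.1 i).1, hyt l]
    · rintro (_ | l) hl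
      exacts [key.2.1 0 (by omega), hyT.1 l (by omega)]
    · rintro (_ | l) hl
      exacts [key.2.2 0 (by omega), hyT.2 l (by omega)]

theorem mem_iterate_of_isTraj (hL : ∀ i j, L i j ≠ ⊤) (hC : ∀ i j, C i j ≠ ⊤)
    (hR : ∀ i j, R i j ≠ ⊤) (k : ℕ) (y : ℕ → Fin n → EReal) (hy : ∀ l i, y l i ≠ ⊤)
    (h : IsTraj L C R (k + 2) y) :
    Sum.elim (y 0) (y 1) ∈ (mpPhi (Abar n) (Bbar n))^[k] (Kset L C R) := by
  induction k generalizing y with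
  | zero => exact (mem_Kset_iff hL hC hR y).2 ⟨fun i => ⟨hy 0 i, hy 1 i⟩, h⟩
  | succ k ih =>
    rw [Function.iterate_succ_apply']
    refine ⟨ih y hy (h.mono (by omega)), ?_, y 2, hy 2, ?_⟩
    · rintro (i | i)
      exacts [hy 0 i, hy 1 i]
    · rw [Abar_Bbar_step]
      exact ih (fun l => y (l + 1)) (fun l => hy (l + 1)) h.tail

theorem finiteTraj_iff (K : ℕ) :
    FiniteTraj L C R K ↔ ∃ y : ℕ → Fin n → ℝ, IsTraj L C R K (fun k i => (y k i : EReal)) := by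
  constructor
  · rintro ⟨x, hc, hlr⟩
    refine ⟨fun k => if h : k < K then x ⟨k, h⟩ else 0, fun k hk i j => ?_, fun k hk i j => ?_⟩
    · simpa [hk] using iSup_le_iff.1 (hc ⟨k, hk⟩ i) j
    · have hk' : k < K := by omega
      have := hlr ⟨k, hk'⟩ hk i
      simpa [hk, hk'] using And.intro (iSup_le_iff.1 this.1 j) (iSup_le_iff.1 this.2 j)
  · rintro ⟨y, hc, hlr⟩
    exact ⟨fun k => y k, fun k i => iSup_le fun j => hc k k.2 i j, fun k hk i =>
      ⟨iSup_le fun j => (hlr k hk i j).1, iSup_le fun j => (hlr k hk i j).2⟩⟩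

theorem isTraj_iff_MK (K : ℕ) (x : ℕ → Fin n → EReal) :
    IsTraj L C R K x ↔
      ∀ p q : Fin K × Fin n, MK L C R K p q + x q.1 q.2 ≤ x p.1 p.2 := by
  constructor
  · rintro ⟨hc, hlr⟩ ⟨⟨k, hk⟩, i⟩ ⟨⟨l, hl⟩, j⟩
    simp only [MK]
    split_ifs with h1 h2 h3
    · subst h1; exact hc k hk i j
    · subst h2; exact (hlr k hl i j).1
    · subst h3; exact (hlr l hk i j).2
    · simp
  · intro h
    refine ⟨fun k hk i j => ?_, fun k hk i j => ⟨?_, ?_⟩⟩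
    · simpa [MK] using h (⟨k, hk⟩, i) (⟨k, hk⟩, j)
    · simpa [MK] using h (⟨k, by omega⟩, i) (⟨k + 1, hk⟩, j)
    · simpa [MK, show k + 1 + 1 ≠ k by omega] using h (⟨k + 1, hk⟩, i) (⟨k, by omega⟩, j)

/-- A subsolution `x` of `A ⊗ x ≤ x`, together with a real subsolution on the complement of its
support, yields a real subsolution. -/
theorem exists_real_subsolution {V : Type*} [Finite V] {A : V → V → EReal}
    (hA : ∀ p q, A p q ≠ ⊤) {x : V → EReal} (hx : ∀ p, x p ≠ ⊤)
    (hAx : ∀ p q, A p q + x q ≤ x p) (z : V → ℝ)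
    (hz : ∀ p q, x p = ⊥ → x q = ⊥ → A p q + (z q : EReal) ≤ z p) :
    ∃ w : V → ℝ, ∀ p q, A p q + (w q : EReal) ≤ w p := by
  obtain ⟨c, hc⟩ := (Set.finite_range fun v : V × V =>
    (A v.1 v.2).toReal + z v.2 - (x v.1).toReal).bddAbove
  have hc' : ∀ p q, (A p q).toReal + z q - (x p).toReal ≤ c := fun p q => hc ⟨(p, q), rfl⟩
  refine ⟨fun p => if x p = ⊥ then z p - c else (x p).toReal, fun p q => ?_⟩
  by_cases hbot : A p q = ⊥
  · simp [hbot]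
  have hAc := EReal.coe_toReal (hA p q) hbot
  by_cases hq : x q = ⊥
  · by_cases hp : x p = ⊥
    · have := hz p q hp hq
      simp only [hp, hq, if_true]
      rw [← hAc] at this ⊢
      norm_cast at this ⊢
      linarith
    · simp only [hp, hq, if_true, if_false]
      rw [← hAc]
      norm_cast
      linarith [hc' p q]
  · have hqc := EReal.coe_toReal (hx q) hq
    have h := hAx p q
    have hp : x p ≠ ⊥ := by
      intro hp
      rw [hp, ← hAc, ← hqc, ← EReal.coe_add, le_bot_iff] at h
      exact EReal.coe_ne_bot _ h
    simpa only [hp, hq, if_false, hqc, EReal.coe_toReal (hx p) hp] using h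

/-- Realness of the initial block suffices to turn an `ℝ_max` trajectory into a real one. -/
theorem finiteTraj_of_isTraj (hL : ∀ i j, L i j ≠ ⊤) (hC : ∀ i j, C i j ≠ ⊤)
    (hR : ∀ i j, R i j ≠ ⊤) (K : ℕ) (x : ℕ → Fin n → EReal) (hx : ∀ k i, x k i ≠ ⊤)
    (hx0 : ∀ i, x 0 i ≠ ⊥) (h : IsTraj L C R K x) : FiniteTraj L C R K := by
  induction K with
  | zero => exact ⟨fun k => k.elim0, fun k => k.elim0, fun k => k.elim0⟩
  | succ K ih =>
    obtain ⟨z, hz⟩ := (finiteTraj_iff K).1 (ih (h.mono (by omega)))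
    have hM : ∀ p q, MK L C R (K + 1) p q ≠ ⊤ := by
      intro p q
      unfold MK
      split_ifs
      exacts [hC _ _, hL _ _, hR _ _, bot_ne_top]
    obtain ⟨w, hw⟩ := exists_real_subsolution hM (x := fun p => x p.1 p.2) (fun p => hx _ _)
      ((isTraj_iff_MK (K + 1) x).1 h) (fun p => z (p.1 - 1) p.2) (by
        rintro ⟨⟨_ | k, hk⟩, i⟩ ⟨⟨_ | l, hl⟩, j⟩ hp hq
        · exact absurd hp (hx0 i)
        · exact absurd hp (hx0 i)
        · exact absurd hq (hx0 j)
        · simpa [MK] using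
            (isTraj_iff_MK K _).1 hz (⟨k, by omega⟩, i) (⟨l, by omega⟩, j))
    refine (finiteTraj_iff _).2
      ⟨fun k i => if hk : k < K + 1 then w (⟨k, hk⟩, i) else 0, (isTraj_iff_MK _ _).2 fun p q => ?_⟩
    simpa only [p.1.is_lt, q.1.is_lt, dif_pos, Fin.eta, Prod.mk.eta] using hw p q

theorem FiniteTraj.mono {K K' : ℕ} (h : FiniteTraj L C R K) (hK : K' ≤ K) :
    FiniteTraj L C R K' := by
  obtain ⟨y, hy⟩ := (finiteTraj_iff K).1 h
  exact (finiteTraj_iff K').2 ⟨y, hy.mono hK⟩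

theorem iterate_inter_realVecs_nonempty_iff (hL : ∀ i j, L i j ≠ ⊤) (hC : ∀ i j, C i j ≠ ⊤)
    (hR : ∀ i j, R i j ≠ ⊤) (k : ℕ) :
    ((mpPhi (Abar n) (Bbar n))^[k] (Kset L C R) ∩ RealVecs).Nonempty ↔
      FiniteTraj L C R (k + 2) := by
  constructor
  · rintro ⟨x, hx, hreal⟩
    obtain ⟨y, rfl, hyt, hy⟩ := exists_isTraj_of_mem_iterate hL hC hR k x hx
    exact finiteTraj_of_isTraj hL hC hR _ y hyt (fun i => (hreal (.inl i)).2) hy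
  · intro h
    obtain ⟨y, hy⟩ := (finiteTraj_iff _).1 h
    refine ⟨_, mem_iterate_of_isTraj hL hC hR k _ (fun l i => EReal.coe_ne_top _) hy, ?_⟩
    rintro (i | i) <;> simp

end

/-- `φ^k(K) ∩ ℝ^{2n}` reaches the empty set in finitely many
steps iff system (8) is not weakly consistent. -/
theorem stmt_19 (n : ℕ) (hn : 0 < n) (L C R : Fin n → Fin n → EReal)
    (hL : ∀ i j, L i j ≠ ⊤) (hC : ∀ i j, C i j ≠ ⊤) (hR : ∀ i j, R i j ≠ ⊤) :
    (∃ khat : ℕ, ∀ k : ℕ, khat ≤ k →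
        (mpPhi (Abar n) (Bbar n))^[k] (Kset L C R) ∩ RealVecs = ∅) ↔
    ¬ WeaklyConsistent L C R := by
  simp only [← Set.not_nonempty_iff_eq_empty, iterate_inter_realVecs_nonempty_iff hL hC hR,
    WeaklyConsistent, not_forall]
  constructor
  · rintro ⟨k, hk⟩
    exact ⟨k + 2, hk k le_rfl⟩
  · rintro ⟨K, hK⟩
    exact ⟨K, fun k hk h => hK (h.mono (by omega))⟩
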